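/- Suppose 𝒱 satisfies the single-well hypotheses. For σ > 0 with σ² ≤ λ_max and ξ > ζ(−1), define I(ξ;σ) := ½·φ(σ²)·∫₀¹ ∂_s x(σ·t(ξ·q^{2/3}); σ²) dq, where x(s;λ) is the inverse function of s(x;λ), and set ⟨ξ⟩ := √(1+ξ²). Then there exist constants C > 0 and c > 0 such that whenever σ·⟨ξ⟩^{3/4} ≤ c, one has |I(ξ;σ) − 1 + (√2·∂ₓ³𝒱(0;σ²)/(3·(∂ₓ²𝒱(0;σ²))^{3/2}))·σ·∫₀¹ t(ξ·q^{2/3}) dq| ≤ C·σ²·⟨ξ⟩^{3/2}. -/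

import Mathlib

open MeasureTheory Set

noncomputable def pdermix (V : ℝ → ℝ → ℝ) (m n : ℕ) (x lam : ℝ) : ℝ :=
  iteratedDeriv m (fun l => iteratedDeriv n (fun x' => V x' l) x) lam

structure SingleWell (V : ℝ → ℝ → ℝ) (lammax δ pp pm Vp Vm : ℝ) : Prop where
  lammax_pos : 0 < lammax
  delta_pos : 0 < δ
  pp_nonneg : 0 ≤ pp
  pm_nonneg : 0 ≤ pm
  Vp_pos : 0 < Vp
  Vm_pos : 0 < Vm
  smooth : ∀ lam ∈ Icc (0:ℝ) lammax, ContDiff ℝ 5 (fun x => V x lam)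
  V_zero : ∀ lam ∈ Icc (0:ℝ) lammax, V 0 lam = 0
  dV_zero : ∀ lam ∈ Icc (0:ℝ) lammax, deriv (fun x => V x lam) 0 = 0
  d2V_pos : ∀ lam ∈ Icc (0:ℝ) lammax, 0 < iteratedDeriv 2 (fun x => V x lam) 0
  dV_pos : ∀ lam ∈ Icc (0:ℝ) lammax, ∀ x : ℝ, 0 < x → 0 < deriv (fun x' => V x' lam) x
  dV_neg : ∀ lam ∈ Icc (0:ℝ) lammax, ∀ x : ℝ, x < 0 → deriv (fun x' => V x' lam) x < 0
  asympP : ∀ η > (0:ℝ), ∃ X > (0:ℝ), ∀ lam ∈ Icc (0:ℝ) lammax, ∀ x ≥ X,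
      |V x lam - Vp * |x| ^ pp| ≤ η * (Vp * |x| ^ pp)
  asympM : ∀ η > (0:ℝ), ∃ X > (0:ℝ), ∀ lam ∈ Icc (0:ℝ) lammax, ∀ x ≤ -X,
      |V x lam - Vm * |x| ^ pm| ≤ η * (Vm * |x| ^ pm)
  derivP : ∃ C > (0:ℝ), ∃ X > (0:ℝ), ∀ lam ∈ Icc (0:ℝ) lammax, ∀ x ≥ X,
      |deriv (fun x' => V x' lam) x| ≤ C * |x| ^ (pp - 1) ∧
      |iteratedDeriv 2 (fun x' => V x' lam) x| ≤ C * |x| ^ (pp - 2)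
  derivM : ∃ C > (0:ℝ), ∃ X > (0:ℝ), ∀ lam ∈ Icc (0:ℝ) lammax, ∀ x ≤ -X,
      |deriv (fun x' => V x' lam) x| ≤ C * |x| ^ (pm - 1) ∧
      |iteratedDeriv 2 (fun x' => V x' lam) x| ≤ C * |x| ^ (pm - 2)
  mixed_cont : ∀ m ≤ 2, ∀ n ≤ 5, ContinuousOn
      (fun p : ℝ × ℝ => pdermix V m n p.1 p.2)
      (Ioo (-δ) δ ×ˢ Icc (0:ℝ) lammax)

/-- The defining properties of the Langer transformation for potential `W := 𝒱(·;λ) - λ`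
(so that the right-hand side of the ODE is `W x`), turning points `xm < xp`, parameter `b < 0`. -/
def IsLanger (W : ℝ → ℝ) (xm xp b : ℝ) (g : ℝ → ℝ) : Prop :=
  Continuous g ∧ StrictMono g ∧
  g xp = 2 * Real.sqrt (-b) ∧ g xm = -(2 * Real.sqrt (-b)) ∧
  ∀ x : ℝ, x ≠ xm → x ≠ xp →
    DifferentiableAt ℝ g x ∧ 0 < deriv g x ∧
    (deriv g x) ^ 2 * ((1/4) * (g x) ^ 2 + b) = W x

noncomputable def bParam (W : ℝ → ℝ) (xm xp : ℝ) : ℝ :=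
  -(1 / Real.pi) * ∫ x in xm..xp, Real.sqrt (-(W x))
open MeasureTheory Set

/-- The function `ζ : (−1,∞) → ℝ`, given by
`ζ(t) = ((3/2)∫₁ᵗ √(τ²−1) dτ)^{2/3}` for `t ≥ 1` and
`ζ(t) = −((3/2)∫ₜ¹ √(1−τ²) dτ)^{2/3}` for `t < 1`. -/
noncomputable def zeta (t : ℝ) : ℝ :=
  if 1 ≤ t then ((3/2) * ∫ τ in (1:ℝ)..t, Real.sqrt (τ ^ 2 - 1)) ^ ((2:ℝ)/3)
  else -(((3/2) * ∫ τ in t..(1:ℝ), Real.sqrt (1 - τ ^ 2)) ^ ((2:ℝ)/3))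

/-- `tf` is the inverse function `t(·) : (ζ(−1), ∞) → (−1, ∞)` of `ζ`. -/
def IsZetaInv (tf : ℝ → ℝ) : Prop :=
  (∀ t : ℝ, -1 < t → tf (zeta t) = t) ∧
  (∀ u : ℝ, zeta (-1) < u → -1 < tf u ∧ zeta (tf u) = u)


lemma abs_le_mul_pow_succ_of_hasDerivAt {h h' : ℝ → ℝ} {K r : ℝ} {n : ℕ} (hK : 0 ≤ K)
    (h0 : h 0 = 0) (hd : ∀ x, HasDerivAt h (h' x) x)
    (hb : ∀ x, |x| ≤ r → |h' x| ≤ K * |x| ^ n) (x : ℝ) (hx : |x| ≤ r) :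
    |h x| ≤ K * |x| ^ (n + 1) := by
  have key := Convex.norm_image_sub_le_of_norm_hasDerivWithin_le (𝕜 := ℝ) (f := h) (f' := h')
    (s := Icc (-|x|) |x|) (C := K * |x| ^ n) (x := 0) (y := x)
    (fun y _ => (hd y).hasDerivWithinAt)
    (fun y hy => by
      have hy' : |y| ≤ |x| := abs_le.2 hy
      refine (hb y (hy'.trans hx)).trans ?_
      gcongr)
    (convex_Icc _ _) (by simp) (abs_le.1 le_rfl)
  simp only [h0, sub_zero, Real.norm_eq_abs] at key
  calc |h x| ≤ _ := key
    _ = _ := by ring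

/-- Third-order Taylor estimates at a critical zero, for a function and its derivative. -/
lemma taylor_bounds_of_critical_zero {f : ℝ → ℝ} {M r A B : ℝ} (hM : 0 ≤ M)
    (hf : ContDiff ℝ 5 f) (f0 : f 0 = 0) (f1 : deriv f 0 = 0)
    (f2 : iteratedDeriv 2 f 0 = 2 * A) (f3 : iteratedDeriv 3 f 0 = 6 * B)
    (f4 : ∀ x, |x| ≤ r → |iteratedDeriv 4 f x| ≤ M) (x : ℝ) (hx : |x| ≤ r) :
    |deriv f x - (2 * A * x + 3 * B * x ^ 2)| ≤ M * |x| ^ 3 ∧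
      |f x - (A * x ^ 2 + B * x ^ 3)| ≤ M * |x| ^ 4 := by
  have hd : ∀ n : ℕ, n < 5 → ∀ y,
      HasDerivAt (iteratedDeriv n f) (iteratedDeriv (n + 1) f y) y := by
    intro n hn y
    rw [iteratedDeriv_succ]
    exact (hf.differentiable_iteratedDeriv n (by exact_mod_cast hn) y).hasDerivAt
  have hid : ∀ y : ℝ, HasDerivAt (fun z : ℝ => z) 1 y := hasDerivAt_id
  have hsq : ∀ y : ℝ, HasDerivAt (fun z : ℝ => z ^ 2) (2 * y) y := fun y => by
    simpa using hasDerivAt_pow 2 y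
  have hcu : ∀ y : ℝ, HasDerivAt (fun z : ℝ => z ^ 3) (3 * y ^ 2) y := fun y => by
    simpa using hasDerivAt_pow 3 y
  have b3 := abs_le_mul_pow_succ_of_hasDerivAt (h := fun y => iteratedDeriv 3 f y - 6 * B)
    (n := 0) hM (by simp [f3]) (fun y => (hd 3 (by norm_num) y).sub_const _)
    (r := r) (fun y hy => by simpa using f4 y hy)
  have b2 := abs_le_mul_pow_succ_of_hasDerivAt
    (h := fun y => iteratedDeriv 2 f y - (2 * A + 6 * B * y)) hM (by simp [f2])
    (fun y => by
      have := (hd 2 (by norm_num) y).sub (((hid y).const_mul (6 * B)).const_add (2 * A))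
      convert! this using 1; ring) b3
  have b1 := abs_le_mul_pow_succ_of_hasDerivAt
    (h := fun y => iteratedDeriv 1 f y - (2 * A * y + 3 * B * y ^ 2)) hM
    (by simp [iteratedDeriv_one, f1])
    (fun y => by
      have := (hd 1 (by norm_num) y).sub
        (((hid y).const_mul (2 * A)).add ((hsq y).const_mul (3 * B)))
      convert! this using 1; ring) b2
  have b0 := abs_le_mul_pow_succ_of_hasDerivAt
    (h := fun y => iteratedDeriv 0 f y - (A * y ^ 2 + B * y ^ 3)) hM
    (by simp [iteratedDeriv_zero, f0])
    (fun y => by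
      have := (hd 0 (by norm_num) y).sub
        (((hsq y).const_mul A).add ((hcu y).const_mul B))
      convert! this using 1; ring) b1
  exact ⟨by simpa [iteratedDeriv_one] using b1 x hx, by simpa using b0 x hx⟩

set_option maxHeartbeats 400000 in
/-- Second-order expansion of `2 * √g / w` in terms of `x * √g`, where `g` and `w` have the
expansions of `f x / x ^ 2` and `deriv f x / x`. -/
lemma exists_abs_sqrt_div_sub_le {m M : ℝ} (hm : 0 < m) (hM : 0 < M) :
    ∃ r > (0 : ℝ), ∃ C > (0 : ℝ), ∀ a B x g w : ℝ, m ≤ a → a ≤ M → |B| ≤ M → |x| ≤ r →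
      |g - (a ^ 2 + B * x)| ≤ M * x ^ 2 → |w - (2 * a ^ 2 + 3 * B * x)| ≤ M * x ^ 2 →
      0 < g ∧ m / 2 ≤ √g ∧ 0 < w ∧ |√g - a| ≤ C * |x| ∧
        |2 * √g / w - (1 / a - B / a ^ 4 * (x * √g))| ≤ C * (x * √g) ^ 2 := by
  obtain ⟨K, hK⟩ : ∃ K, K = 2 * M / m := ⟨_, rfl⟩
  have hKpos : 0 < K := by rw [hK]; positivity
  obtain ⟨C0, hC0⟩ : ∃ C0, C0 = M ^ 3 * (M + K ^ 2) + M ^ 3 * M +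
      M * (K * (2 * M ^ 2 + 4 * M) + M * (4 * M)) := ⟨_, rfl⟩
  have hC0pos : 0 < C0 := by rw [hC0]; positivity
  refine ⟨min 1 (m ^ 2 / (8 * M)), by positivity, C0 * (4 / m ^ 2) / m ^ 6 + K, by positivity, ?_⟩
  intro a B x g w ha haM hB hx hg hw
  have hx1 : |x| ≤ 1 := hx.trans (min_le_left _ _)
  have hx2 : 8 * M * |x| ≤ m ^ 2 := by
    have := hx.trans (min_le_right _ _)
    rw [le_div_iff₀ (by positivity)] at this
    linarith
  have ha0 : 0 < a := hm.trans_le ha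
  have hxx : x ^ 2 ≤ |x| := by
    rw [← sq_abs]; nlinarith [abs_nonneg x]
  have hBx : |B * x| ≤ M * |x| := by rw [abs_mul]; gcongr
  have hBx3 : |3 * B * x| ≤ 3 * M * |x| := by
    rw [mul_assoc, abs_mul, abs_of_pos (by norm_num : (0:ℝ) < 3)]; linarith
  have hga : |g - a ^ 2| ≤ 2 * M * |x| := by
    have : g - a ^ 2 = (g - (a ^ 2 + B * x)) + B * x := by ring
    rw [this]
    refine (abs_add_le _ _).trans ?_
    nlinarith
  have hwa : |w - 2 * a ^ 2| ≤ 4 * M * |x| := by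
    have : w - 2 * a ^ 2 = (w - (2 * a ^ 2 + 3 * B * x)) + 3 * B * x := by ring
    rw [this]
    refine (abs_add_le _ _).trans ?_
    nlinarith
  have hma : m ^ 2 ≤ a ^ 2 := by gcongr
  have hm2 : 0 < m ^ 2 := by positivity
  have hgpos : m ^ 2 / 2 ≤ g := by
    have := (abs_le.1 hga).1
    linarith
  have hg0 : 0 < g := by linarith
  have hwpos : m ^ 2 ≤ w := by
    have := (abs_le.1 hwa).1
    linarith
  have hw0 : 0 < w := by linarith
  set u := √g with hu
  have hu2 : u ^ 2 = g := Real.sq_sqrt hg0.le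
  have hu0 : 0 < u := Real.sqrt_pos.2 hg0
  have hum : m / 2 ≤ u := by
    apply Real.le_sqrt_of_sq_le
    nlinarith
  have hp : |u - a| ≤ K * |x| := by
    have h1 : |u - a| * m ≤ 2 * M * |x| := by
      calc |u - a| * m ≤ |u - a| * (u + a) := by gcongr; linarith
        _ = |g - a ^ 2| := by
          rw [← hu2, sq_sub_sq, mul_comm (u + a), abs_mul, abs_of_pos (add_pos hu0 ha0)]
        _ ≤ _ := hga
    rw [hK, div_mul_eq_mul_div, le_div_iff₀ hm]; exact h1
  have hcpos : 0 ≤ C0 * (4 / m ^ 2) / m ^ 6 := by positivity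
  refine ⟨hg0, hum, hw0, hp.trans (by gcongr; linarith), ?_⟩
  obtain ⟨p, hpdef⟩ : ∃ p, p = u - a := ⟨_, rfl⟩
  rw [← hpdef] at hp
  obtain ⟨e1, he1⟩ : ∃ e1, e1 = g - (a ^ 2 + B * x) := ⟨_, rfl⟩
  rw [← he1] at hg
  obtain ⟨e2, he2⟩ : ∃ e2, e2 = w - (2 * a ^ 2 + 3 * B * x) := ⟨_, rfl⟩
  rw [← he2] at hw
  have hua : u = a + p := by rw [hpdef]; ring
  have hN : 2 * u * a ^ 4 - a ^ 3 * w + B * x * u * w =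
      a ^ 3 * (e1 - p ^ 2) - a ^ 3 * e2 + B * x * (p * w + a * (w - 2 * a ^ 2)) := by
    rw [he1, he2, ← hu2, hua]; ring
  have hww : |w| ≤ 2 * M ^ 2 + 4 * M := by
    have h1 := (abs_le.1 hwa).2
    have h2 : a ^ 2 ≤ M ^ 2 := by gcongr
    rw [abs_of_pos hw0]
    nlinarith
  have hNb : |2 * u * a ^ 4 - a ^ 3 * w + B * x * u * w| ≤ C0 * x ^ 2 := by
    rw [hN]
    have ha3 : |a ^ 3| ≤ M ^ 3 := by rw [abs_of_pos (by positivity)]; gcongr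
    have hp2 : p ^ 2 ≤ K ^ 2 * x ^ 2 := by
      rw [← sq_abs p, ← sq_abs x, ← mul_pow]; gcongr
    have t1 : |a ^ 3 * (e1 - p ^ 2)| ≤ M ^ 3 * ((M + K ^ 2) * x ^ 2) := by
      rw [abs_mul]
      gcongr
      refine (abs_sub _ _).trans ?_
      rw [abs_of_nonneg (sq_nonneg p)]
      linarith
    have t2 : |a ^ 3 * e2| ≤ M ^ 3 * (M * x ^ 2) := by
      rw [abs_mul]; gcongr
    have t3 : |B * x * (p * w + a * (w - 2 * a ^ 2))| ≤
        M * |x| * (K * |x| * (2 * M ^ 2 + 4 * M) + M * (4 * M * |x|)) := by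
      rw [abs_mul]
      gcongr
      refine (abs_add_le _ _).trans ?_
      rw [abs_mul, abs_mul, abs_of_pos ha0]
      gcongr
    calc _ ≤ |a ^ 3 * (e1 - p ^ 2)| + |a ^ 3 * e2| + |B * x * (p * w + a * (w - 2 * a ^ 2))| := by
          refine (abs_add_le _ _).trans ?_
          gcongr
          exact abs_sub _ _
      _ ≤ _ := add_le_add (add_le_add t1 t2) t3
      _ = _ := by rw [hC0, ← sq_abs x]; ring
  have hD : 2 * u / w - (1 / a - B / a ^ 4 * (x * u)) =
      (2 * u * a ^ 4 - a ^ 3 * w + B * x * u * w) / (a ^ 4 * w) := by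
    field_simp
    ring
  rw [hD, abs_div, abs_of_pos (by positivity : 0 < a ^ 4 * w)]
  have hx2u : x ^ 2 ≤ 4 / m ^ 2 * (x * u) ^ 2 := by
    have hmu : m ^ 2 ≤ 4 * u ^ 2 := by
      have := pow_le_pow_left₀ (by positivity) hum 2
      linarith
    rw [div_mul_eq_mul_div, le_div_iff₀ hm2]
    calc x ^ 2 * m ^ 2 ≤ x ^ 2 * (4 * u ^ 2) := by gcongr
      _ = _ := by ring
  calc _ ≤ C0 * (4 / m ^ 2 * (x * u) ^ 2) / (m ^ 4 * m ^ 2) := by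
        gcongr
        exact hNb.trans (by gcongr)
    _ = C0 * (4 / m ^ 2) / m ^ 6 * (x * u) ^ 2 := by ring
    _ ≤ _ := by gcongr; linarith

/-- Uniform second-order expansion of the derivative of the inverse of the signed square root of a
function with a nondegenerate minimum. -/
lemma exists_abs_deriv_inverse_sub_le {m M r : ℝ} (hm : 0 < m) (hM : 0 < M) (hr : 0 < r) :
    ∃ s₀ > (0 : ℝ), ∃ C > (0 : ℝ), ∀ (f Y : ℝ → ℝ) (a B : ℝ), ContDiff ℝ 5 f → f 0 = 0 →
      deriv f 0 = 0 → m ≤ a → a ≤ M → |B| ≤ M → iteratedDeriv 2 f 0 = 2 * a ^ 2 →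
      iteratedDeriv 3 f 0 = 6 * B → (∀ x, |x| ≤ r → |iteratedDeriv 4 f x| ≤ M) →
      (∀ x, Y (Real.sign x * √(f x)) = x) → ∀ s, |s| < s₀ →
        f (Y s) = s ^ 2 ∧ 0 < deriv Y s ∧ |deriv Y s - (1 / a - B / a ^ 4 * s)| ≤ C * s ^ 2 := by
  obtain ⟨r₁, hr₁, C, hC, key⟩ := exists_abs_sqrt_div_sub_le hm hM
  obtain ⟨ρ, hρ⟩ : ∃ ρ, ρ = min r r₁ := ⟨_, rfl⟩
  have hρ0 : 0 < ρ := by rw [hρ]; positivity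
  refine ⟨m * ρ / 4, by positivity, C, hC, ?_⟩
  intro f Y a B hf f0 f1 ham haM hB f2 f3 f4 hY
  have ha0 : 0 < a := hm.trans_le ham
  have hT := taylor_bounds_of_critical_zero hM.le hf f0 f1 f2 f3 f4
  let g : ℝ → ℝ := fun x => if x = 0 then a ^ 2 else f x / x ^ 2
  let w : ℝ → ℝ := fun x => if x = 0 then 2 * a ^ 2 else deriv f x / x
  let S : ℝ → ℝ := fun x => x * √(g x)
  have hkey : ∀ x, |x| ≤ ρ → 0 < g x ∧ m / 2 ≤ √(g x) ∧ 0 < w x ∧ |√(g x) - a| ≤ C * |x| ∧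
        |2 * √(g x) / w x - (1 / a - B / a ^ 4 * (x * √(g x)))| ≤ C * (x * √(g x)) ^ 2 := by
    intro x hx
    have hxr : |x| ≤ r := hx.trans (hρ ▸ min_le_left _ _)
    refine key a B x (g x) (w x) ham haM hB (hx.trans (hρ ▸ min_le_right _ _)) ?_ ?_
    · by_cases h0 : x = 0
      · simp [g, h0]
      · have hx2 : 0 < x ^ 2 := by positivity
        have : g x - (a ^ 2 + B * x) = (f x - (a ^ 2 * x ^ 2 + B * x ^ 3)) / x ^ 2 := by
          simp only [g, h0, if_false]; field_simp
        rw [this, abs_div, abs_of_pos hx2, div_le_iff₀ hx2]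
        calc _ ≤ _ := (hT x hxr).2
          _ = M * (|x| ^ 2) ^ 2 := by ring
          _ = _ := by rw [sq_abs]; ring
    · by_cases h0 : x = 0
      · simp [w, h0]
      · have hx2 : 0 < |x| := abs_pos.2 h0
        have : w x - (2 * a ^ 2 + 3 * B * x) =
            (deriv f x - (2 * a ^ 2 * x + 3 * B * x ^ 2)) / x := by
          simp only [w, h0, if_false]; field_simp
        rw [this, abs_div, div_le_iff₀ hx2]
        calc _ ≤ _ := (hT x hxr).1
          _ = M * |x| ^ 2 * |x| := by ring
          _ = _ := by rw [sq_abs]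
  have hfg : ∀ x, f x = x ^ 2 * g x := by
    intro x
    by_cases h0 : x = 0
    · simp [h0, f0]
    · simp only [g, h0, if_false]; field_simp
  have hSs : ∀ x, S x = Real.sign x * √(f x) := by
    intro x
    rw [hfg x, Real.sqrt_mul (sq_nonneg x), Real.sqrt_sq_eq_abs, ← mul_assoc]
    change x * √(g x) = _
    congr 1
    rcases lt_trichotomy x 0 with h | h | h
    · simp [Real.sign_of_neg h, abs_of_neg h]
    · simp [h]
    · simp [Real.sign_of_pos h, abs_of_pos h]
  have hYS : ∀ x, Y (S x) = x := fun x => by rw [hSs]; exact hY x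
  have hSd : ∀ x, |x| < ρ → HasDerivAt S (w x / (2 * √(g x))) x := by
    intro x hx
    obtain ⟨hg, -, -, -, -⟩ := hkey x hx.le
    by_cases h0 : x = 0
    · subst h0
      have hv : w 0 / (2 * √(g 0)) = a := by
        simp only [w, g, if_true, Real.sqrt_sq ha0.le]
        field_simp
      rw [hv, hasDerivAt_iff_tendsto_slope, tendsto_iff_norm_sub_tendsto_zero]
      have hlim : Filter.Tendsto (fun y : ℝ => C * |y|) (nhdsWithin 0 {0}ᶜ) (nhds 0) := by
        have : Filter.Tendsto (fun y : ℝ => C * |y|) (nhds 0) (nhds (C * |(0 : ℝ)|)) :=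
          Continuous.tendsto (by fun_prop) _
        simp only [abs_zero, mul_zero] at this
        exact this.mono_left nhdsWithin_le_nhds
      refine squeeze_zero' (Filter.Eventually.of_forall fun y => norm_nonneg _) ?_ hlim
      have hev : ∀ᶠ y in nhdsWithin (0 : ℝ) {0}ᶜ, |y| < ρ := by
        apply Filter.Eventually.filter_mono nhdsWithin_le_nhds
        exact (continuous_abs.tendsto (0 : ℝ)).eventually_lt_const (by simpa using hρ0)
      filter_upwards [hev, self_mem_nhdsWithin] with y hy hy0
      have hy0' : y ≠ 0 := hy0
      have : slope S 0 y = √(g y) := by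
        simp [slope_def_field, S, hy0']
      rw [this, Real.norm_eq_abs]
      exact (hkey y hy.le).2.2.2.1
    · have hfx : 0 < f x := by rw [hfg x]; positivity
      have hfd : HasDerivAt f (deriv f x) x :=
        (hf.differentiable (by norm_num) x).hasDerivAt
      have h1 : HasDerivAt (fun y => Real.sign x * √(f y))
          (Real.sign x * (deriv f x / (2 * √(f x)))) x := (hfd.sqrt hfx.ne').const_mul _
      have h2 : S =ᶠ[nhds x] fun y => Real.sign x * √(f y) := by
        rcases lt_or_gt_of_ne h0 with h | h
        · filter_upwards [Iio_mem_nhds h] with y hy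
          rw [hSs, Real.sign_of_neg h, Real.sign_of_neg hy]
        · filter_upwards [Ioi_mem_nhds h] with y hy
          rw [hSs, Real.sign_of_pos h, Real.sign_of_pos hy]
      have h3 := h1.congr_of_eventuallyEq h2
      convert! h3 using 1
      have hs : √(f x) = |x| * √(g x) := by
        rw [hfg x, Real.sqrt_mul (sq_nonneg x), Real.sqrt_sq_eq_abs]
      have hg' : √(g x) ≠ 0 := (Real.sqrt_pos.2 hg).ne'
      rw [hs]
      simp only [w, h0, if_false]
      rcases lt_or_gt_of_ne h0 with h | h
      · rw [Real.sign_of_neg h, abs_of_neg h]; field_simp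
      · rw [Real.sign_of_pos h, abs_of_pos h]; field_simp
  have hScont : ContinuousOn S (Ioo (-ρ) ρ) := fun x hx =>
    (hSd x (abs_lt.2 hx)).continuousAt.continuousWithinAt
  have hSpos : ∀ x, |x| < ρ → 0 < w x / (2 * √(g x)) := fun x hx => by
    obtain ⟨hg, -, hw, -, -⟩ := hkey x hx.le
    have := Real.sqrt_pos.2 hg
    positivity
  have hSmono : StrictMonoOn S (Ioo (-ρ) ρ) := by
    refine strictMonoOn_of_deriv_pos (convex_Ioo _ _) hScont fun x hx => ?_
    rw [interior_Ioo] at hx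
    rw [(hSd x (abs_lt.2 hx)).deriv]
    exact hSpos x (abs_lt.2 hx)
  have hYd : ∀ x, |x| < ρ → HasDerivAt Y (w x / (2 * √(g x)))⁻¹ (S x) := by
    intro x hx
    have hx' := abs_lt.1 hx
    obtain ⟨y, hy1, hy2⟩ := exists_between hx'.1
    obtain ⟨z, hz1, hz2⟩ := exists_between hx'.2
    have hsub : Icc y z ⊆ Ioo (-ρ) ρ := fun t ht => ⟨hy1.trans_le ht.1, ht.2.trans_lt hz2⟩
    have hnhds : S '' Ioo (-ρ) ρ ∈ nhds (S x) := by
      have hyx : S y < S x := hSmono ⟨hy1, hy2.trans hx'.2⟩ hx' hy2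
      have hxz : S x < S z := hSmono hx' ⟨hx'.1.trans hz1, hz2⟩ hz1
      refine Filter.mem_of_superset (Icc_mem_nhds hyx hxz) ?_
      exact (intermediate_value_Icc (hy2.trans hz1).le (hScont.mono hsub)).trans
        (image_mono hsub)
    have hYmono : StrictMonoOn Y (S '' Ioo (-ρ) ρ) := by
      rintro _ ⟨p, hp, rfl⟩ _ ⟨q, hq, rfl⟩ hpq
      rw [hYS, hYS]
      exact (hSmono.lt_iff_lt hp hq).1 hpq
    have hYc : ContinuousAt Y (S x) := by
      refine hYmono.continuousAt_of_image_mem_nhds hnhds ?_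
      have : Y '' (S '' Ioo (-ρ) ρ) = Ioo (-ρ) ρ := by
        rw [image_image]; simp [hYS]
      rw [this, hYS]
      exact Ioo_mem_nhds hx'.1 hx'.2
    refine HasDerivAt.of_local_left_inverse (f := S) hYc ?_ (hSpos x hx).ne' ?_
    · rw [hYS]; exact hSd x hx
    · filter_upwards [hnhds] with t ht
      obtain ⟨p, -, rfl⟩ := ht
      rw [hYS]
  intro s hs
  have hmem : s ∈ S '' Icc (-(ρ / 2)) (ρ / 2) := by
    have hsub : Icc (-(ρ / 2)) (ρ / 2) ⊆ Ioo (-ρ) ρ := fun t ht =>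
      ⟨by linarith [ht.1], by linarith [ht.2]⟩
    refine intermediate_value_Icc (by linarith) (hScont.mono hsub) ?_
    have h1 := (hkey (ρ / 2) (by rw [abs_of_pos (by positivity)]; linarith)).2.1
    have h2 := (hkey (-(ρ / 2)) (by rw [abs_neg, abs_of_pos (by positivity)]; linarith)).2.1
    have hs' := abs_lt.1 hs
    constructor
    · change -(ρ / 2) * √(g (-(ρ / 2))) ≤ s
      nlinarith
    · change s ≤ ρ / 2 * √(g (ρ / 2))
      nlinarith
  obtain ⟨x, hx, rfl⟩ := hmem
  have hxρ : |x| < ρ := (abs_le.2 hx).trans_lt (by linarith)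
  obtain ⟨hg, -, hw, -, hest⟩ := hkey x hxρ.le
  rw [(hYd x hxρ).deriv, hYS]
  refine ⟨?_, inv_pos.2 (hSpos x hxρ), ?_⟩
  · change f x = (x * √(g x)) ^ 2
    rw [mul_pow, Real.sq_sqrt hg.le, hfg x]
  · rw [inv_div]; exact hest

lemma integral_sqrt_sq_sub_sq {σ : ℝ} (hσ : 0 < σ) :
    ∫ s in (-σ)..σ, √(σ ^ 2 - s ^ 2) = Real.pi * σ ^ 2 / 2 := by
  have h := intervalIntegral.mul_integral_comp_mul_left (a := -1) (b := 1)
    (f := fun s => √(σ ^ 2 - s ^ 2)) σ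
  have h2 : ∀ x : ℝ, √(σ ^ 2 - (σ * x) ^ 2) = σ * √(1 - x ^ 2) := fun x => by
    rw [show σ ^ 2 - (σ * x) ^ 2 = σ ^ 2 * (1 - x ^ 2) by ring, Real.sqrt_mul (sq_nonneg σ),
      Real.sqrt_sq hσ.le]
  simp only [h2, intervalIntegral.integral_const_mul, integral_sqrt_one_sub_sq] at h
  simp only [mul_neg, mul_one] at h
  rw [← h]
  ring

lemma integral_mul_sqrt_sq_sub_sq (σ : ℝ) : ∫ s in (-σ)..σ, s * √(σ ^ 2 - s ^ 2) = 0 := by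
  have h := intervalIntegral.integral_comp_neg (a := -σ) (b := σ)
    (fun s : ℝ => s * √(σ ^ 2 - s ^ 2))
  simp only [neg_neg, neg_mul, neg_sq, intervalIntegral.integral_neg] at h
  linarith

lemma abs_neg_bParam_sub_le {f Y : ℝ → ℝ} {s₀ C a β σ : ℝ} (hC : 0 ≤ C)
    (hY : ∀ s, |s| < s₀ → f (Y s) = s ^ 2 ∧ 0 < deriv Y s ∧
      |deriv Y s - (1 / a - β * s)| ≤ C * s ^ 2) (hσ : 0 < σ) (hσs : σ < s₀) :
    |-(bParam (fun x => f x - σ ^ 2) (Y (-σ)) (Y σ)) - σ ^ 2 / (2 * a)| ≤ C * σ ^ 4 := by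
  have hmem : ∀ s ∈ Icc (-σ) σ, |s| ≤ σ ∧ |s| < s₀ := fun s hs =>
    ⟨abs_le.2 hs, (abs_le.2 hs).trans_lt hσs⟩
  have hd : ∀ s ∈ Icc (-σ) σ, HasDerivAt Y (deriv Y s) s := fun s hs =>
    (differentiableAt_of_deriv_ne_zero (hY s (hmem s hs).2).2.1.ne').hasDerivAt
  have hle : -σ ≤ σ := by linarith
  have huI : uIcc (-σ) σ = Icc (-σ) σ := uIcc_of_le hle
  have hcont : ContinuousOn Y (Icc (-σ) σ) := fun s hs =>
    (hd s hs).continuousAt.continuousWithinAt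
  have hmono : MonotoneOn Y (Icc (-σ) σ) := by
    refine monotoneOn_of_deriv_nonneg (convex_Icc _ _) hcont ?_ ?_
    · intro s hs
      exact (hd s (interior_subset hs)).differentiableAt.differentiableWithinAt
    · intro s hs
      exact (hY s (hmem s (interior_subset hs)).2).2.1.le
  have hcv : ∫ x in (Y (-σ))..(Y σ), √(-(f x - σ ^ 2)) =
      ∫ s in (-σ)..σ, √(σ ^ 2 - s ^ 2) * deriv Y s := by
    rw [← intervalIntegral.integral_comp_mul_deriv_of_deriv_nonneg (f' := deriv Y)
      (huI ▸ hcont)]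
    · refine intervalIntegral.integral_congr fun s hs => ?_
      rw [huI] at hs
      simp only [Function.comp, (hY s (hmem s hs).2).1, neg_sub]
    · intro s hs
      rw [min_eq_left hle, max_eq_right hle] at hs
      exact hd s (Ioo_subset_Icc_self hs)
    · intro s hs
      rw [min_eq_left hle, max_eq_right hle] at hs
      exact (hY s (hmem s (Ioo_subset_Icc_self hs)).2).2.1.le
  have hw : Continuous fun s : ℝ => √(σ ^ 2 - s ^ 2) := by fun_prop
  have hint1 : IntervalIntegrable (fun s => √(σ ^ 2 - s ^ 2) * deriv Y s) volume (-σ) σ :=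
    (huI ▸ hmono).intervalIntegrable_deriv.continuousOn_mul hw.continuousOn
  have hint2 : IntervalIntegrable (fun s => √(σ ^ 2 - s ^ 2) * (1 / a - β * s)) volume (-σ) σ :=
    Continuous.intervalIntegrable (by fun_prop) _ _
  have hmain : ∫ s in (-σ)..σ, √(σ ^ 2 - s ^ 2) * (1 / a - β * s) =
      1 / a * (Real.pi * σ ^ 2 / 2) := by
    have : ∀ s : ℝ, √(σ ^ 2 - s ^ 2) * (1 / a - β * s) =
        1 / a * √(σ ^ 2 - s ^ 2) - β * (s * √(σ ^ 2 - s ^ 2)) := fun s => by ring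
    simp only [this]
    rw [intervalIntegral.integral_sub (Continuous.intervalIntegrable (by fun_prop) _ _)
      (Continuous.intervalIntegrable (by fun_prop) _ _), intervalIntegral.integral_const_mul,
      intervalIntegral.integral_const_mul, integral_sqrt_sq_sub_sq hσ,
      integral_mul_sqrt_sq_sub_sq, mul_zero, sub_zero]
  have herr : |(∫ s in (-σ)..σ, √(σ ^ 2 - s ^ 2) * deriv Y s) -
      1 / a * (Real.pi * σ ^ 2 / 2)| ≤ 2 * C * σ ^ 4 := by
    rw [← hmain, ← intervalIntegral.integral_sub hint1 hint2]
    have h := intervalIntegral.norm_integral_le_of_norm_le_const (a := -σ) (b := σ)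
      (C := σ * (C * σ ^ 2)) (f := fun s => √(σ ^ 2 - s ^ 2) * deriv Y s -
        √(σ ^ 2 - s ^ 2) * (1 / a - β * s)) (fun s hs => by
        have hs' : s ∈ Icc (-σ) σ := huI ▸ uIoc_subset_uIcc hs
        have h1 : √(σ ^ 2 - s ^ 2) ≤ σ := by
          rw [Real.sqrt_le_left hσ.le]; nlinarith [sq_nonneg s]
        rw [← mul_sub, Real.norm_eq_abs, abs_mul, abs_of_nonneg (Real.sqrt_nonneg _)]
        refine mul_le_mul h1 ((hY s (hmem s hs').2).2.2.trans ?_) (abs_nonneg _) hσ.le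
        have h2 : s ^ 2 ≤ σ ^ 2 := sq_le_sq' hs'.1 hs'.2
        gcongr)
    rw [Real.norm_eq_abs, abs_of_pos (by linarith : 0 < σ - -σ)] at h
    calc _ ≤ _ := h
      _ = _ := by ring
  unfold bParam
  rw [hcv]
  obtain ⟨J, hJ⟩ : ∃ J, J = ∫ s in (-σ)..σ, √(σ ^ 2 - s ^ 2) * deriv Y s := ⟨_, rfl⟩
  rw [← hJ] at herr ⊢
  have hpi := Real.pi_pos
  have : -(-(1 / Real.pi) * J) - σ ^ 2 / (2 * a) =
      (J - 1 / a * (Real.pi * σ ^ 2 / 2)) / Real.pi := by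
    by_cases ha : a = 0
    · simp [ha]; ring
    · field_simp
  rw [this, abs_div, abs_of_pos hpi, div_le_iff₀ hpi]
  have : 0 ≤ C * σ ^ 4 := by positivity
  nlinarith [Real.pi_gt_three]

lemma continuous_sqrt_sq_sub_one : Continuous fun τ : ℝ => √(τ ^ 2 - 1) := by fun_prop

lemma continuous_sqrt_one_sub_sq : Continuous fun τ : ℝ => √(1 - τ ^ 2) := by fun_prop

lemma zeta_mono : Monotone zeta := by
  intro s t hst
  have hmul : (0:ℝ) ≤ 3 / 2 := by norm_num
  unfold zeta
  split_ifs with h1 h2 h2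
  · have hs : 0 ≤ ∫ τ in (1:ℝ)..s, √(τ ^ 2 - 1) :=
      intervalIntegral.integral_nonneg h1 fun _ _ => Real.sqrt_nonneg _
    have := intervalIntegral.integral_mono_interval (μ := volume) le_rfl h1 hst
      (Filter.Eventually.of_forall fun τ => Real.sqrt_nonneg (τ ^ 2 - 1))
      (continuous_sqrt_sq_sub_one.intervalIntegrable _ _)
    gcongr
  · exact absurd (h1.trans hst) h2
  · have hs : 0 ≤ ∫ τ in s..(1:ℝ), √(1 - τ ^ 2) :=
      intervalIntegral.integral_nonneg (not_le.1 h1).le fun _ _ => Real.sqrt_nonneg _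
    have ht : 0 ≤ ∫ τ in (1:ℝ)..t, √(τ ^ 2 - 1) :=
      intervalIntegral.integral_nonneg h2 fun _ _ => Real.sqrt_nonneg _
    calc _ ≤ (0:ℝ) := neg_nonpos.2 (by positivity)
      _ ≤ _ := by positivity
  · have ht : 0 ≤ ∫ τ in t..(1:ℝ), √(1 - τ ^ 2) :=
      intervalIntegral.integral_nonneg (not_le.1 h2).le fun _ _ => Real.sqrt_nonneg _
    have := intervalIntegral.integral_mono_interval (μ := volume) hst (not_le.1 h2).le le_rfl
      (Filter.Eventually.of_forall fun τ => Real.sqrt_nonneg (1 - τ ^ 2))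
      (continuous_sqrt_one_sub_sq.intervalIntegrable _ _)
    gcongr

lemma zeta_neg_one_neg : zeta (-1) < 0 := by
  unfold zeta
  rw [if_neg (by norm_num), integral_sqrt_one_sub_sq]
  have := Real.pi_pos
  exact neg_neg_of_pos (by positivity)

lemma le_of_one_le_of_zeta {t : ℝ} (ht : 1 ≤ t) : t ≤ 1 + 2 * |zeta t| ^ ((3:ℝ) / 4) := by
  have hI : (t - 1) ^ 2 / 2 ≤ ∫ τ in (1:ℝ)..t, √(τ ^ 2 - 1) := by
    have h1 : ∫ τ in (1:ℝ)..t, (τ - 1) = (t - 1) ^ 2 / 2 := by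
      rw [intervalIntegral.integral_sub (by simp) (by simp), integral_id]
      simp; ring
    rw [← h1]
    refine intervalIntegral.integral_mono_on ht
      (Continuous.intervalIntegrable (by fun_prop) _ _)
      (continuous_sqrt_sq_sub_one.intervalIntegrable _ _) fun τ hτ => ?_
    apply Real.le_sqrt_of_sq_le
    nlinarith [hτ.1]
  have hz : zeta t = (3 / 2 * ∫ τ in (1:ℝ)..t, √(τ ^ 2 - 1)) ^ ((2:ℝ) / 3) := if_pos ht
  obtain ⟨J, hJ⟩ : ∃ J, J = ∫ τ in (1:ℝ)..t, √(τ ^ 2 - 1) := ⟨_, rfl⟩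
  rw [← hJ] at hI hz
  have hJ0 : 0 ≤ J := le_trans (by positivity) hI
  have hp : |zeta t| ^ ((3:ℝ) / 4) = √(3 / 2 * J) := by
    rw [hz, abs_of_nonneg (by positivity), ← Real.rpow_mul (by positivity), Real.sqrt_eq_rpow]
    norm_num
  rw [hp]
  have : (t - 1) / 2 ≤ √(3 / 2 * J) := by
    apply Real.le_sqrt_of_sq_le
    nlinarith [sq_nonneg (t - 1)]
  linarith

namespace IsZetaInv

variable {tf : ℝ → ℝ}

lemma monotoneOn (htf : IsZetaInv tf) : MonotoneOn tf (Ioi (zeta (-1))) := by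
  intro u hu v hv huv
  by_contra! h
  have := zeta_mono h.le
  rw [(htf.2 u hu).2, (htf.2 v hv).2] at this
  rw [le_antisymm huv this] at h
  exact lt_irrefl _ h

lemma abs_le (htf : IsZetaInv tf) {u : ℝ} (hu : zeta (-1) < u) :
    |tf u| ≤ 1 + 2 * |u| ^ ((3:ℝ) / 4) := by
  obtain ⟨h1, h2⟩ := htf.2 u hu
  have hpos : 0 ≤ |u| ^ ((3:ℝ) / 4) := by positivity
  rw [_root_.abs_le]
  refine ⟨by linarith, ?_⟩
  rcases le_or_gt 1 (tf u) with h | h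
  · have := le_of_one_le_of_zeta h
    rwa [h2] at this
  · linarith

lemma lt_mul_rpow {ξ q : ℝ} (hξ : zeta (-1) < ξ) (hq : q ∈ Icc (0:ℝ) 1) :
    zeta (-1) < ξ * q ^ ((2:ℝ) / 3) := by
  have h0 : 0 ≤ q ^ ((2:ℝ) / 3) := Real.rpow_nonneg hq.1 _
  have h1 : q ^ ((2:ℝ) / 3) ≤ 1 := Real.rpow_le_one hq.1 hq.2 (by norm_num)
  have := zeta_neg_one_neg
  rcases le_or_gt 0 ξ with h | h
  · have := mul_nonneg h h0; linarith
  · nlinarith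

lemma intervalIntegrable (htf : IsZetaInv tf) {ξ : ℝ} (hξ : zeta (-1) < ξ) :
    IntervalIntegrable (fun q : ℝ => tf (ξ * q ^ ((2:ℝ) / 3))) volume 0 1 := by
  have hu : uIcc (0:ℝ) 1 = Icc 0 1 := uIcc_of_le zero_le_one
  rcases le_or_gt 0 ξ with h | h
  · refine MonotoneOn.intervalIntegrable ?_
    rw [hu]
    intro p hp q hq hpq
    refine htf.monotoneOn (lt_mul_rpow hξ hp) (lt_mul_rpow hξ hq) ?_
    exact mul_le_mul_of_nonneg_left (Real.rpow_le_rpow hp.1 hpq (by norm_num)) h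
  · refine AntitoneOn.intervalIntegrable ?_
    rw [hu]
    intro p hp q hq hpq
    refine htf.monotoneOn (lt_mul_rpow hξ hq) (lt_mul_rpow hξ hp) ?_
    exact mul_le_mul_of_nonpos_left (Real.rpow_le_rpow hp.1 hpq (by norm_num)) h.le

lemma abs_mul_rpow_le (htf : IsZetaInv tf) {ξ q : ℝ} (hξ : zeta (-1) < ξ)
    (hq : q ∈ Icc (0:ℝ) 1) :
    |tf (ξ * q ^ ((2:ℝ) / 3))| ≤ 3 * √(1 + ξ ^ 2) ^ ((3:ℝ) / 4) := by
  have h0 : 0 ≤ q ^ ((2:ℝ) / 3) := Real.rpow_nonneg hq.1 _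
  have h1 : q ^ ((2:ℝ) / 3) ≤ 1 := Real.rpow_le_one hq.1 hq.2 (by norm_num)
  have hle : |ξ * q ^ ((2:ℝ) / 3)| ≤ √(1 + ξ ^ 2) := by
    rw [abs_mul, abs_of_nonneg h0]
    calc |ξ| * q ^ ((2:ℝ) / 3) ≤ |ξ| * 1 := by gcongr
      _ ≤ √(1 + ξ ^ 2) := by
        rw [mul_one, ← Real.sqrt_sq_eq_abs]; exact Real.sqrt_le_sqrt (by linarith)
  have hone : (1:ℝ) ≤ √(1 + ξ ^ 2) ^ ((3:ℝ) / 4) :=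
    Real.one_le_rpow (Real.one_le_sqrt.2 (by nlinarith [sq_nonneg ξ])) (by norm_num)
  have hr : |ξ * q ^ ((2:ℝ) / 3)| ^ ((3:ℝ) / 4) ≤ √(1 + ξ ^ 2) ^ ((3:ℝ) / 4) := by gcongr
  have := htf.abs_le (lt_mul_rpow hξ hq)
  linarith

end IsZetaInv

lemma SingleWell.exists_uniform_bounds {V : ℝ → ℝ → ℝ} {lammax δ pp pm Vp Vm : ℝ}
    (hV : SingleWell V lammax δ pp pm Vp Vm) :
    ∃ m > (0:ℝ), ∃ M > (0:ℝ), ∃ r > (0:ℝ), ∀ lam ∈ Icc (0:ℝ) lammax,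
      m ≤ √(iteratedDeriv 2 (fun x => V x lam) 0 / 2) ∧
      √(iteratedDeriv 2 (fun x => V x lam) 0 / 2) ≤ M ∧
      |iteratedDeriv 3 (fun x => V x lam) 0 / 6| ≤ M ∧
      ∀ x, |x| ≤ r → |iteratedDeriv 4 (fun x => V x lam) x| ≤ M := by
  have hδ := hV.delta_pos
  have hcont : ∀ n ≤ 5, ContinuousOn
      (fun p : ℝ × ℝ => iteratedDeriv n (fun x => V x p.2) p.1)
      (Ioo (-δ) δ ×ˢ Icc (0:ℝ) lammax) := fun n hn => by
    simpa [pdermix, iteratedDeriv_zero] using hV.mixed_cont 0 (by norm_num) n hn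
  have hslice : ∀ n ≤ 5, ContinuousOn
      (fun lam : ℝ => iteratedDeriv n (fun x => V x lam) 0) (Icc 0 lammax) := fun n hn =>
    (hcont n hn).comp (f := fun lam : ℝ => ((0:ℝ), lam)) (by fun_prop)
      (fun lam hlam => ⟨⟨by linarith, hδ⟩, hlam⟩)
  have hsqrt : ContinuousOn
      (fun lam : ℝ => √(iteratedDeriv 2 (fun x => V x lam) 0 / 2)) (Icc 0 lammax) :=
    ((hslice 2 (by norm_num)).div_const 2).sqrt
  obtain ⟨l₀, hl₀, hmin⟩ := isCompact_Icc.exists_isMinOn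
    (nonempty_Icc.2 hV.lammax_pos.le) hsqrt
  obtain ⟨M₁, hM₁⟩ := isCompact_Icc.exists_bound_of_continuousOn hsqrt
  obtain ⟨M₂, hM₂⟩ := isCompact_Icc.exists_bound_of_continuousOn
    ((hslice 3 (by norm_num)).div_const 6)
  have hsub : Icc (-(δ / 2)) (δ / 2) ×ˢ Icc (0:ℝ) lammax ⊆ Ioo (-δ) δ ×ˢ Icc (0:ℝ) lammax :=
    prod_mono (fun x hx => ⟨by linarith [hx.1], by linarith [hx.2]⟩) le_rfl
  obtain ⟨M₃, hM₃⟩ := (isCompact_Icc.prod isCompact_Icc).exists_bound_of_continuousOn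
    ((hcont 4 (by norm_num)).mono hsub)
  have h1 : M₁ ≤ max 1 (max M₁ (max M₂ M₃)) := by simp
  have h2 : M₂ ≤ max 1 (max M₁ (max M₂ M₃)) := by simp
  have h3 : M₃ ≤ max 1 (max M₁ (max M₂ M₃)) := by simp
  refine ⟨√(iteratedDeriv 2 (fun x => V x l₀) 0 / 2),
    Real.sqrt_pos.2 (half_pos (hV.d2V_pos l₀ hl₀)), max 1 (max M₁ (max M₂ M₃)),
    lt_max_of_lt_left one_pos, δ / 2, by positivity, fun lam hlam => ⟨hmin hlam, ?_, ?_, ?_⟩⟩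
  · exact (le_abs_self _).trans ((hM₁ lam hlam).trans h1)
  · exact (hM₂ lam hlam).trans h2
  · intro x hx
    exact (hM₃ (x, lam) ⟨_root_.abs_le.1 hx, hlam⟩).trans h3

/-- If `N` is close to `σ² / (2a)`, then `σ² / (2N)` is close to `a`. -/
lemma abs_half_mul_div_sub_le {a M C N σ : ℝ} (ha : 0 < a) (haM : a ≤ M) (hC : 0 ≤ C)
    (hσ : 0 < σ) (hCσ : C * σ ^ 2 ≤ 1 / (4 * M)) (hN : |N - σ ^ 2 / (2 * a)| ≤ C * σ ^ 4) :
    |1 / 2 * (σ ^ 2 / N) - a| ≤ 4 * M ^ 2 * C * σ ^ 2 := by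
  have hσ2 : 0 < σ ^ 2 := by positivity
  have hCa : C * σ ^ 2 ≤ 1 / (4 * a) := hCσ.trans (by gcongr)
  have h1 : C * σ ^ 4 ≤ σ ^ 2 / (4 * a) := by
    calc C * σ ^ 4 = (C * σ ^ 2) * σ ^ 2 := by ring
      _ ≤ 1 / (4 * a) * σ ^ 2 := by gcongr
      _ = _ := by ring
  have h2 : σ ^ 2 / (4 * a) ≤ N := by
    have h3 := (abs_le.1 hN).1
    have h4 : σ ^ 2 / (2 * a) = σ ^ 2 / (4 * a) + σ ^ 2 / (4 * a) := by field_simp; norm_num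
    linarith
  have hN0 : 0 < N := lt_of_lt_of_le (by positivity) h2
  have h5 : 1 / 2 * (σ ^ 2 / N) - a = -(a * (N - σ ^ 2 / (2 * a))) / N := by
    field_simp; ring
  rw [h5, abs_div, abs_neg, abs_mul, abs_of_pos ha, abs_of_pos hN0, div_le_iff₀ hN0]
  calc a * |N - σ ^ 2 / (2 * a)| ≤ a * (C * σ ^ 4) := by gcongr
    _ = 4 * a ^ 2 * C * σ ^ 2 * (σ ^ 2 / (4 * a)) := by field_simp
    _ ≤ 4 * M ^ 2 * C * σ ^ 2 * N := by gcongr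

/-- Averaging a first-order expansion of `d` along `q ↦ σ * t q`. -/
lemma integral_comp_expansion {d t : ℝ → ℝ} {s₀ C κ β σ T : ℝ} (hC : 0 ≤ C)
    (hdm : Measurable d) (hd : ∀ s, |s| < s₀ → |d s - (κ - β * s)| ≤ C * s ^ 2)
    (hσ : 0 < σ) (hσT : σ * T < s₀) (ht : IntervalIntegrable t volume 0 1)
    (htT : ∀ q ∈ Icc (0:ℝ) 1, |t q| ≤ T) :
    |(∫ q in (0:ℝ)..1, d (σ * t q)) - (κ - β * σ * ∫ q in (0:ℝ)..1, t q)| ≤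
        C * (σ * T) ^ 2 ∧
      |∫ q in (0:ℝ)..1, d (σ * t q)| ≤ |κ| + |β| * s₀ + C * s₀ ^ 2 := by
  have hsT : ∀ q ∈ Icc (0:ℝ) 1, |σ * t q| ≤ σ * T := fun q hq => by
    rw [abs_mul, abs_of_pos hσ]
    exact mul_le_mul_of_nonneg_left (htT q hq) hσ.le
  have hIoc : ∀ q ∈ uIoc (0:ℝ) 1, q ∈ Icc (0:ℝ) 1 := fun q hq => by
    rw [uIoc_of_le zero_le_one] at hq; exact Ioc_subset_Icc_self hq
  have hs₀ : 0 ≤ s₀ :=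
    ((abs_nonneg _).trans (hsT 0 (by simp))).trans hσT.le
  have hdb : ∀ q ∈ uIoc (0:ℝ) 1, ‖d (σ * t q)‖ ≤ |κ| + |β| * s₀ + C * s₀ ^ 2 := by
    intro q hq
    have h1 := (hsT q (hIoc q hq)).trans_lt hσT
    have h2 : (σ * t q) ^ 2 ≤ s₀ ^ 2 := by
      rw [← sq_abs]; gcongr
    have h3 : |β * (σ * t q)| ≤ |β| * s₀ := by rw [abs_mul]; gcongr
    have h4 : C * (σ * t q) ^ 2 ≤ C * s₀ ^ 2 := by gcongr
    have h5 : d (σ * t q) = (d (σ * t q) - (κ - β * (σ * t q))) + (κ - β * (σ * t q)) := by ring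
    rw [Real.norm_eq_abs, h5]
    refine (abs_add_le _ _).trans ?_
    have h6 := hd _ h1
    have h7 := abs_sub κ (β * (σ * t q))
    linarith
  have hint : IntervalIntegrable (fun q => d (σ * t q)) volume 0 1 := by
    have hc : IntervalIntegrable (fun _ : ℝ => |κ| + |β| * s₀ + C * s₀ ^ 2) volume 0 1 :=
      intervalIntegrable_const
    refine hc.mono_fun' ?_ ?_
    · exact (hdm.comp_aemeasurable
        (ht.def'.aestronglyMeasurable.aemeasurable.const_mul σ)).aestronglyMeasurable
    · exact (ae_restrict_iff' measurableSet_uIoc).2 (Filter.Eventually.of_forall hdb)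
  constructor
  · have hlin : ∫ q in (0:ℝ)..1, (κ - β * σ * t q) = κ - β * σ * ∫ q in (0:ℝ)..1, t q := by
      rw [intervalIntegral.integral_sub intervalIntegrable_const (ht.const_mul _),
        intervalIntegral.integral_const_mul]
      simp
    rw [← hlin, ← intervalIntegral.integral_sub hint
      (intervalIntegrable_const.sub (ht.const_mul _))]
    have h := intervalIntegral.norm_integral_le_of_norm_le_const (a := 0) (b := 1)
      (C := C * (σ * T) ^ 2) (f := fun q => d (σ * t q) - (κ - β * σ * t q)) (fun q hq => by
        have h1 := hsT q (hIoc q hq)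
        have h2 : (σ * t q) ^ 2 ≤ (σ * T) ^ 2 := by
          rw [← sq_abs]; gcongr
        rw [Real.norm_eq_abs, mul_assoc β σ]
        exact (hd _ (h1.trans_lt hσT)).trans (by gcongr))
    simpa using h
  · simpa using intervalIntegral.norm_integral_le_of_norm_le_const hdb

/-- **Expansion of `I(ξ;σ)`.**
With `I(ξ;σ) = ½ φ(σ²) ∫₀¹ ∂ₛx(σ t(ξ q^{2/3}); σ²) dq`, one has
`I(ξ;σ) = 1 − (√2 𝒱'''(0;σ²)/(3𝒱''(0;σ²)^{3/2})) σ ∫₀¹ t(ξ q^{2/3}) dq + O(σ²⟨ξ⟩^{3/2})`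
whenever `σ⟨ξ⟩^{3/4}` is sufficiently small. -/
theorem I_expansion (V : ℝ → ℝ → ℝ) (lammax δ pp pm Vp Vm : ℝ)
    (hV : SingleWell V lammax δ pp pm Vp Vm)
    (xm xp : ℝ → ℝ)
    (hx : ∀ lam : ℝ, 0 < lam → lam ≤ lammax →
      xm lam < 0 ∧ 0 < xp lam ∧ V (xm lam) lam = lam ∧ V (xp lam) lam = lam)
    (tf : ℝ → ℝ) (htf : IsZetaInv tf)
    (X : ℝ → ℝ → ℝ)
    (hX : ∀ lam ∈ Icc (0:ℝ) lammax, ∀ x : ℝ,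
      X (Real.sign x * Real.sqrt (V x lam)) lam = x) :
    ∃ C > (0:ℝ), ∃ c > (0:ℝ), ∀ σ ξ : ℝ, 0 < σ → σ ^ 2 ≤ lammax → zeta (-1) < ξ →
      σ * (Real.sqrt (1 + ξ ^ 2)) ^ ((3:ℝ)/4) ≤ c →
      |(1/2) * (σ ^ 2 /
            (-(bParam (fun x => V x (σ ^ 2) - σ ^ 2) (xm (σ ^ 2)) (xp (σ ^ 2))))) *
          (∫ q in (0:ℝ)..1, deriv (fun sv => X sv (σ ^ 2)) (σ * tf (ξ * q ^ ((2:ℝ)/3))))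
        - 1
        + Real.sqrt 2 * iteratedDeriv 3 (fun x => V x (σ ^ 2)) 0 /
            (3 * (iteratedDeriv 2 (fun x => V x (σ ^ 2)) 0) ^ ((3:ℝ)/2)) * σ *
          (∫ q in (0:ℝ)..1, tf (ξ * q ^ ((2:ℝ)/3)))| ≤
        C * σ ^ 2 * (Real.sqrt (1 + ξ ^ 2)) ^ ((3:ℝ)/2) := by
  obtain ⟨m, hm, M, hM, r, hr, hbd⟩ := hV.exists_uniform_bounds
  obtain ⟨s₀, hs₀, C, hC, hinv⟩ := exists_abs_deriv_inverse_sub_le hm hM hr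
  obtain ⟨L, hL⟩ : ∃ L, L = 1 / m + M / m ^ 4 * s₀ + C * s₀ ^ 2 := ⟨_, rfl⟩
  have hL0 : 0 < L := by rw [hL]; positivity
  refine ⟨4 * M ^ 2 * C * L + 9 * M * C, by positivity,
    min (s₀ / 6) (min 1 (1 / (4 * M * C))), by positivity, ?_⟩
  intro σ ξ hσ hσl hξ hσξ
  have hone : (1:ℝ) ≤ √(1 + ξ ^ 2) ^ ((3:ℝ) / 4) :=
    Real.one_le_rpow (Real.one_le_sqrt.2 (by nlinarith [sq_nonneg ξ])) (by norm_num)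
  have hTT : √(1 + ξ ^ 2) ^ ((3:ℝ) / 2) = (√(1 + ξ ^ 2) ^ ((3:ℝ) / 4)) ^ 2 := by
    rw [← Real.rpow_mul_natCast (Real.sqrt_nonneg _)]; norm_num
  rw [hTT]
  have htT := fun q hq => htf.abs_mul_rpow_le (q := q) hξ hq
  obtain ⟨T, hT⟩ : ∃ T, T = √(1 + ξ ^ 2) ^ ((3:ℝ) / 4) := ⟨_, rfl⟩
  simp only [← hT] at hone hσξ htT ⊢
  have hσT : σ * T ≤ s₀ / 6 := hσξ.trans (min_le_left _ _)
  have hσc : σ ≤ min (s₀ / 6) (min 1 (1 / (4 * M * C))) :=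
    (le_mul_of_one_le_right hσ.le hone).trans hσξ
  have hσs : σ < s₀ := (hσc.trans (min_le_left _ _)).trans_lt (by linarith)
  have hσ1 : σ ≤ 1 := hσc.trans ((min_le_right _ _).trans (min_le_left _ _))
  have hCσ : C * σ ^ 2 ≤ 1 / (4 * M) := by
    have h1 : σ ≤ 1 / (4 * M * C) := hσc.trans ((min_le_right _ _).trans (min_le_right _ _))
    calc C * σ ^ 2 ≤ C * σ := by gcongr; nlinarith
      _ ≤ C * (1 / (4 * M * C)) := by gcongr
      _ = _ := by field_simp
  have hσ2 : 0 < σ ^ 2 := by positivity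
  have hmem : σ ^ 2 ∈ Icc (0:ℝ) lammax := ⟨hσ2.le, hσl⟩
  obtain ⟨hma, haM, hBM, hf4⟩ := hbd _ hmem
  have hf2 := hV.d2V_pos _ hmem
  obtain ⟨hxm, hxp, hVm, hVp⟩ := hx _ hσ2 hσl
  have hY := hinv (fun x => V x (σ ^ 2)) (fun s => X s (σ ^ 2)) _ _ (hV.smooth _ hmem)
    (hV.V_zero _ hmem) (hV.dV_zero _ hmem) hma haM hBM
    (by rw [Real.sq_sqrt (half_pos hf2).le]; ring) (by ring) hf4 (hX _ hmem)
  have hXp : X σ (σ ^ 2) = xp (σ ^ 2) := by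
    have := hX _ hmem (xp (σ ^ 2))
    rwa [hVp, Real.sign_of_pos hxp, Real.sqrt_sq hσ.le, one_mul] at this
  have hXm : X (-σ) (σ ^ 2) = xm (σ ^ 2) := by
    have := hX _ hmem (xm (σ ^ 2))
    rwa [hVm, Real.sign_of_neg hxm, Real.sqrt_sq hσ.le, neg_one_mul] at this
  have hk : √2 * iteratedDeriv 3 (fun x => V x (σ ^ 2)) 0 /
      (3 * iteratedDeriv 2 (fun x => V x (σ ^ 2)) 0 ^ ((3:ℝ) / 2)) =
      iteratedDeriv 3 (fun x => V x (σ ^ 2)) 0 / 6 /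
        √(iteratedDeriv 2 (fun x => V x (σ ^ 2)) 0 / 2) ^ 3 := by
    have h2 : (0:ℝ) < √2 := by positivity
    have h22 : √2 ^ 2 = (2:ℝ) := Real.sq_sqrt (by norm_num)
    have hrp : iteratedDeriv 2 (fun x => V x (σ ^ 2)) 0 ^ ((3:ℝ) / 2) =
        √(iteratedDeriv 2 (fun x => V x (σ ^ 2)) 0) ^ 3 := by
      rw [Real.sqrt_eq_rpow, ← Real.rpow_mul_natCast hf2.le]; norm_num
    have hs := Real.sqrt_pos.2 hf2
    rw [hrp, Real.sqrt_div hf2.le, div_pow]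
    field_simp
    linear_combination (-3 * iteratedDeriv 3 (fun x => V x (σ ^ 2)) 0) * h22
  rw [hk]
  generalize √(iteratedDeriv 2 (fun x => V x (σ ^ 2)) 0 / 2) = a at *
  generalize iteratedDeriv 3 (fun x => V x (σ ^ 2)) 0 / 6 = B at *
  have ha0 : 0 < a := hm.trans_le hma
  have hb := abs_neg_bParam_sub_le (f := fun x => V x (σ ^ 2)) (Y := fun s => X s (σ ^ 2))
    (a := a) (β := B / a ^ 4) hC.le hY hσ hσs
  simp only [hXp, hXm] at hb
  have hP := abs_half_mul_div_sub_le ha0 haM hC.le hσ hCσ hb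
  obtain ⟨hJ, hJL⟩ := integral_comp_expansion (T := 3 * T) hC.le (measurable_deriv _)
    (fun s hs => (hY s hs).2.2) hσ (by linarith) (htf.intervalIntegrable hξ) htT
  generalize 1 / 2 * (σ ^ 2 / -bParam (fun x => V x (σ ^ 2) - σ ^ 2) (xm (σ ^ 2)) (xp (σ ^ 2))) =
    P at *
  generalize (∫ q in (0:ℝ)..1, deriv (fun sv => X sv (σ ^ 2)) (σ * tf (ξ * q ^ ((2:ℝ) / 3)))) =
    J at *
  generalize (∫ q in (0:ℝ)..1, tf (ξ * q ^ ((2:ℝ) / 3))) = μ at *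
  have hJL' : |J| ≤ L := by
    refine hJL.trans ?_
    rw [hL, abs_of_pos (by positivity : 0 < 1 / a), abs_div, abs_of_pos (by positivity : 0 < a ^ 4)]
    gcongr
  have hsplit : P * J - 1 + B / a ^ 3 * σ * μ =
      (P - a) * J + a * (J - (1 / a - B / a ^ 4 * σ * μ)) := by
    field_simp; ring
  rw [hsplit]
  calc _ ≤ |P - a| * |J| + a * |J - (1 / a - B / a ^ 4 * σ * μ)| := by
        refine (abs_add_le _ _).trans ?_
        rw [abs_mul, abs_mul, abs_of_pos ha0]
    _ ≤ 4 * M ^ 2 * C * σ ^ 2 * L + M * (C * (σ * (3 * T)) ^ 2) := by gcongr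
    _ = 4 * M ^ 2 * C * L * σ ^ 2 * 1 + 9 * M * C * σ ^ 2 * T ^ 2 := by ring
    _ ≤ 4 * M ^ 2 * C * L * σ ^ 2 * T ^ 2 + 9 * M * C * σ ^ 2 * T ^ 2 := by
        gcongr
        exact one_le_pow₀ hone
    _ = _ := by ring
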